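/- Suppose ϱ is continuous and strictly positive on (0,∞) with ϱ = 0 on (−∞,0], and there exist c₁, c₂ > 0 and r ∈ (0,2) such that ϱ(θ) ≤ c₁ e^{c₂ θ^r} for all θ > 0 and f(x) ≤ c₁ e^{c₂ |x|^r} for all x ∈ ℝ, where f : ℝ → [0,∞) is Borel measurable. Then for every compact set B ⊂ (0,∞), every δ > 0 and every ε > 0, sup_{θ₀ ∈ B} ℙ( ∫_{|λ| > δ√(I_N)} f(λ)·|ϱ(θ̂_N^{θ₀} + λ/√(I_N)) − ϱ(θ₀)|·e^{−λ²/2} dλ > ε ) → 0 as N → ∞. -/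

import Mathlib

open MeasureTheory ProbabilityTheory Filter Real

/-- A subquadratic power is dominated by `t ^ 2 / 4` up to an additive constant. -/
lemma exists_mul_rpow_add_le {r : ℝ} (hr₀ : 0 < r) (hr₂ : r < 2) {a K : ℝ} (ha : 0 ≤ a)
    (hK : 0 ≤ K) : ∃ C : ℝ, ∀ t : ℝ, 0 ≤ t → a * (K + t) ^ r ≤ C + t ^ 2 / 4 := by
  have hlim : Tendsto (fun u : ℝ => a * u ^ (-(2 - r))) atTop (nhds 0) := by
    simpa using (tendsto_rpow_neg_atTop (sub_pos.2 hr₂)).const_mul a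
  obtain ⟨R, hR⟩ := eventually_atTop.1 (hlim.eventually_le_const (by norm_num : (0 : ℝ) < 1 / 8))
  refine ⟨a * (max R 1) ^ r + K ^ 2 / 4, fun t ht => ?_⟩
  have hR1 : (0 : ℝ) < max R 1 := lt_max_of_lt_right one_pos
  rcases le_total (K + t) (max R 1) with h | h
  · have : a * (K + t) ^ r ≤ a * (max R 1) ^ r := by gcongr
    nlinarith [sq_nonneg t, sq_nonneg K]
  · have hpos : 0 < K + t := hR1.trans_le h
    have hbd := hR (K + t) ((le_max_left _ _).trans h)
    have heq : (K + t) ^ r = (K + t) ^ (-(2 - r)) * (K + t) ^ 2 := by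
      rw [← Real.rpow_natCast (K + t) 2, ← Real.rpow_add hpos]
      congr 1
      push_cast
      ring
    have hnn : 0 ≤ a * (max R 1) ^ r := by positivity
    rw [heq]
    nlinarith [mul_le_mul_of_nonneg_right hbd (sq_nonneg (K + t)), sq_nonneg (K - t)]

/-- Gaussian weights integrate exponentials of subquadratic powers. -/
lemma integrable_exp_rpow_add_mul_exp_neg_sq {r : ℝ} (hr₀ : 0 < r) (hr₂ : r < 2) {a K : ℝ}
    (ha : 0 ≤ a) (hK : 0 ≤ K) :
    Integrable fun l : ℝ => Real.exp (a * (K + |l|) ^ r) * Real.exp (-(l ^ 2) / 2) := by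
  obtain ⟨C, hC⟩ := exists_mul_rpow_add_le hr₀ hr₂ ha hK
  refine ((integrable_exp_neg_mul_sq (by norm_num : (0 : ℝ) < 1 / 4)).const_mul
    (Real.exp C)).mono' (by fun_prop) (ae_of_all _ fun l => ?_)
  rw [Real.norm_of_nonneg (by positivity), ← Real.exp_add, ← Real.exp_add]
  refine Real.exp_le_exp.2 ?_
  have := hC |l| (abs_nonneg l)
  rw [sq_abs] at this
  linarith

lemma measurableSet_lt_abs (R : ℝ) : MeasurableSet {x : ℝ | R < |x|} :=
  measurableSet_lt measurable_const measurable_norm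

/-- The integral of an integrable function over `{R < |l|}` vanishes as `R → ∞`. -/
lemma tendsto_setIntegral_lt_abs_atTop {g : ℝ → ℝ} (hg : Integrable g) :
    Tendsto (fun R : ℝ => ∫ l in {l : ℝ | R < |l|}, g l) atTop (nhds 0) := by
  simp_rw [← integral_indicator (measurableSet_lt_abs _)]
  rw [← integral_zero ℝ ℝ]
  refine tendsto_integral_filter_of_dominated_convergence (fun l => ‖g l‖)
    (Eventually.of_forall fun R => (hg.indicator (measurableSet_lt_abs R)).aestronglyMeasurable)
    (Eventually.of_forall fun R => ae_of_all _ fun l => norm_indicator_le_norm_self _ _) hg.norm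
    (ae_of_all _ fun l => tendsto_const_nhds.congr' ?_)
  filter_upwards [eventually_ge_atTop |l|] with R hR
  exact (Set.indicator_of_notMem (by simpa using hR) g).symm

/-- The mass a finite measure on `ℝ` gives to `{R < |x|}` vanishes as `R → ∞`. -/
lemma tendsto_measure_lt_abs_atTop (μ : Measure ℝ) [IsFiniteMeasure μ] :
    Tendsto (fun R : ℝ => μ {x : ℝ | R < |x|}) atTop (nhds 0) := by
  rw [← measure_empty (μ := μ)]
  refine tendsto_measure_of_tendsto_indicator_of_isFiniteMeasure atTop μ measurableSet_lt_abs fun x => ?_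
  filter_upwards [eventually_ge_atTop |x|] with R hR
  simpa using hR

/-- Uniform version (outer region) of the key Bernstein–Von Mises lemma: for priors and test
functions of at most exponential growth, the weighted integral over `{|λ| > δ √I_N}` of
`f(λ)|ϱ(θ̂_N^{θ₀} + λ/√I_N) − ϱ(θ₀)| e^{−λ²/2}` tends to `0` in probability, uniformly in
`θ₀` over compact subsets of `(0,∞)`. -/
theorem uniform_bvm_lemma_outer
    {Ω : Type*} [MeasurableSpace Ω] (P : Measure Ω) [IsProbabilityMeasure P]
    (ξ : ℕ → Ω → ℝ) (hξMeas : ∀ N, Measurable (ξ N))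
    (hξGauss : ∀ N, Measure.map (ξ N) P = gaussianReal 0 1)
    (I : ℕ → ℝ) (hIpos : ∀ N, 0 < I N) (hItop : Tendsto I atTop atTop)
    (ρ : ℝ → ℝ) (hρMeas : Measurable ρ) (hρnonneg : ∀ x, 0 ≤ ρ x)
    (hρzero : ∀ x ≤ (0 : ℝ), ρ x = 0)
    (hρcont : ContinuousOn ρ (Set.Ioi 0)) (hρpos : ∀ θ : ℝ, 0 < θ → 0 < ρ θ)
    (f : ℝ → ℝ) (hfMeas : Measurable f) (hfnonneg : ∀ x, 0 ≤ f x)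
    (c₁ c₂ r : ℝ) (hc₁ : 0 < c₁) (hc₂ : 0 < c₂) (hr₀ : 0 < r) (hr₂ : r < 2)
    (hρgrowth : ∀ θ : ℝ, 0 < θ → ρ θ ≤ c₁ * Real.exp (c₂ * θ ^ r))
    (hfgrowth : ∀ x : ℝ, f x ≤ c₁ * Real.exp (c₂ * |x| ^ r)) :
    ∀ B : Set ℝ, IsCompact B → B ⊆ Set.Ioi 0 → ∀ δ > (0 : ℝ), ∀ ε > (0 : ℝ),
      Tendsto (fun N => ⨆ θ₀ ∈ B,
          P {ω : Ω |
            ε < ∫ l in {l : ℝ | δ * Real.sqrt (I N) < |l|},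
              f l * |ρ (θ₀ + ξ N ω / Real.sqrt (I N) + l / Real.sqrt (I N)) - ρ θ₀|
                * Real.exp (-(l ^ 2) / 2)})
        atTop (nhds 0) := by
  intro B hB hBpos δ hδ ε hε
  obtain ⟨M, hM⟩ := hB.isBounded.exists_norm_le
  set K : ℝ := |M| + 1
  have hK : 0 ≤ K := by positivity
  set g : ℝ → ℝ := fun l =>
    2 * c₁ ^ 2 * (Real.exp (2 * c₂ * (K + |l|) ^ r) * Real.exp (-(l ^ 2) / 2)) with hg
  have hgint : Integrable g :=
    (integrable_exp_rpow_add_mul_exp_neg_sq hr₀ hr₂ (by positivity) hK).const_mul _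
  have hρle (x y : ℝ) (h : |x| ≤ y) : ρ x ≤ c₁ * Real.exp (c₂ * y ^ r) := by
    rcases le_or_gt x 0 with hx | hx
    · rw [hρzero x hx]
      positivity
    · rw [abs_of_pos hx] at h
      exact (hρgrowth x hx).trans (by gcongr)
  have hsqrt : Tendsto (fun N => Real.sqrt (I N)) atTop atTop :=
    Real.tendsto_sqrt_atTop.comp hItop
  have htail : ∀ᶠ N in atTop, ∫ l in {l : ℝ | δ * Real.sqrt (I N) < |l|}, g l ≤ ε :=
    ((tendsto_setIntegral_lt_abs_atTop hgint).comp
      (hsqrt.const_mul_atTop hδ)).eventually_le_const hε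
  refine tendsto_of_tendsto_of_tendsto_of_le_of_le' tendsto_const_nhds
    ((tendsto_measure_lt_abs_atTop (gaussianReal 0 1)).comp hsqrt)
    (Eventually.of_forall fun N => zero_le) ?_
  filter_upwards [htail, hsqrt.eventually_ge_atTop 1] with N hN hs
  refine iSup₂_le fun θ hθ => ?_
  have hθM : |θ| ≤ |M| := (hM θ hθ).trans (le_abs_self M)
  rw [Function.comp_apply, ← hξGauss N, Measure.map_apply (hξMeas N) (measurableSet_lt_abs _)]
  refine measure_mono fun ω hω => ?_
  by_contra hξ
  have hξ' : |ξ N ω| ≤ Real.sqrt (I N) := by simpa using hξ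
  refine absurd hω (not_lt.2 (le_trans ?_ hN))
  refine integral_mono_of_nonneg (ae_of_all _ fun l => ?_) hgint.integrableOn
    (ae_of_all _ fun l => ?_)
  · exact mul_nonneg (mul_nonneg (hfnonneg l) (abs_nonneg _)) (Real.exp_pos _).le
  have hspos : 0 < Real.sqrt (I N) := one_pos.trans_le hs
  have hl := abs_nonneg l
  have h₁ : |ξ N ω / Real.sqrt (I N)| ≤ 1 := by
    rw [abs_div, abs_of_pos hspos]
    exact (div_le_one hspos).2 hξ'
  have h₂ : |l / Real.sqrt (I N)| ≤ |l| := by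
    rw [abs_div, abs_of_pos hspos]
    exact div_le_self hl hs
  have h₃ : |θ + ξ N ω / Real.sqrt (I N) + l / Real.sqrt (I N)| ≤ K + |l| :=
    (abs_add_three _ _ _).trans (by gcongr; simp only [K]; linarith)
  have h₄ : |θ| ≤ K + |l| := by simp only [K]; linarith
  set E : ℝ := Real.exp (c₂ * (K + |l|) ^ r) with hE
  have hf : f l ≤ c₁ * E := (hfgrowth l).trans (by rw [hE]; gcongr; linarith)
  have hdiff : |ρ (θ + ξ N ω / Real.sqrt (I N) + l / Real.sqrt (I N)) - ρ θ| ≤ 2 * (c₁ * E) := by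
    have hx := hρle _ _ h₃
    have hy := hρle _ _ h₄
    have hx₀ := hρnonneg (θ + ξ N ω / Real.sqrt (I N) + l / Real.sqrt (I N))
    have hy₀ := hρnonneg θ
    rw [abs_le]
    constructor <;> linarith
  calc f l * |ρ (θ + ξ N ω / Real.sqrt (I N) + l / Real.sqrt (I N)) - ρ θ|
        * Real.exp (-(l ^ 2) / 2)
      ≤ (c₁ * E) * (2 * (c₁ * E)) * Real.exp (-(l ^ 2) / 2) := by gcongr
    _ = 2 * c₁ ^ 2 * (E ^ 2 * Real.exp (-(l ^ 2) / 2)) := by ring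
    _ = g l := by
      simp only [hg, hE, ← Real.exp_nat_mul]
      push_cast
      ring_nf
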